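/- arXiv:2301.05758 — 2 statements merged into one kernel-verified Lean document; each statement's English description precedes it below -/
import Mathlib

section
/- Let P be the Pell sequence (P_0 = 0, P_1 = 1, P_n = 2P_{n-1} + P_{n-2}) and Q the associated Pell sequence (Q_0 = 1, Q_1 = 1, Q_n = 2Q_{n-1} + Q_{n-2}). For all integers s, r ≥ 1 with s even: if s ≡ 0 (mod 4) then Q_{s+r} − Q_r = 4·P_{s/2}·P_{s/2+r}, and if s ≡ 2 (mod 4) then Q_{s+r} − Q_r = 2·Q_{s/2}·Q_{s/2+r}. -/
/-- The Pell sequence: P₀ = 0, P₁ = 1, Pₙ = 2Pₙ₋₁ + Pₙ₋₂. -/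
def pell : ℕ → ℤ
  | 0 => 0
  | 1 => 1
  | n + 2 => 2 * pell (n + 1) + pell n

/-- The associated Pell sequence: Q₀ = 1, Q₁ = 1, Qₙ = 2Qₙ₋₁ + Qₙ₋₂. -/
def assocPell : ℕ → ℤ
  | 0 => 1
  | 1 => 1
  | n + 2 => 2 * assocPell (n + 1) + assocPell n

theorem pell_succ_and_assocPell_succ (n : ℕ) :
    pell (n + 1) = pell n + assocPell n ∧ assocPell (n + 1) = assocPell n + 2 * pell n := by
  induction n with
  | zero => simp [pell, assocPell]
  | succ n ih =>
    obtain ⟨hP, hQ⟩ := ih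
    constructor
    · rw [pell]; linarith
    · rw [assocPell]; linarith

theorem pell_add_and_assocPell_add (m n : ℕ) :
    pell (m + n) = pell m * assocPell n + assocPell m * pell n ∧
      assocPell (m + n) = assocPell m * assocPell n + 2 * pell m * pell n := by
  induction n with
  | zero => simp [pell, assocPell]
  | succ n ih =>
    obtain ⟨hP, hQ⟩ := ih
    obtain ⟨hP₁, hQ₁⟩ := pell_succ_and_assocPell_succ n
    obtain ⟨hP₂, hQ₂⟩ := pell_succ_and_assocPell_succ (m + n)
    rw [← add_assoc, hP₂, hQ₂, hP₁, hQ₁, hP, hQ]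
    constructor <;> ring

theorem assocPell_sq_sub_two_mul_pell_sq (n : ℕ) :
    assocPell n ^ 2 - 2 * pell n ^ 2 = (-1) ^ n := by
  induction n with
  | zero => simp [pell, assocPell]
  | succ n ih =>
    obtain ⟨hP, hQ⟩ := pell_succ_and_assocPell_succ n
    rw [pow_succ (-1 : ℤ), ← ih, hP, hQ]
    ring

theorem assocPell_mul_sub_two_mul_pell_mul (m r : ℕ) :
    assocPell m * assocPell (m + r) - 2 * pell m * pell (m + r) = (-1) ^ m * assocPell r := by
  obtain ⟨hP, hQ⟩ := pell_add_and_assocPell_add m r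
  rw [hP, hQ, ← assocPell_sq_sub_two_mul_pell_sq]
  ring

theorem assocPell_sub_assocPell (s r : ℕ) (hs : 1 ≤ s) (hr : 1 ≤ r) (hse : s % 2 = 0) :
    (s % 4 = 0 → assocPell (s + r) - assocPell r = 4 * pell (s / 2) * pell (s / 2 + r)) ∧
    (s % 4 = 2 → assocPell (s + r) - assocPell r = 2 * assocPell (s / 2) * assocPell (s / 2 + r)) := by
  obtain ⟨m, rfl⟩ : ∃ m, s = m + m := ⟨s / 2, by omega⟩
  have hm : (m + m) / 2 = m := by omega
  have hQ := (pell_add_and_assocPell_add m (m + r)).2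
  have hsub := assocPell_mul_sub_two_mul_pell_mul m r
  rw [hm, add_assoc]
  constructor <;> intro h
  · rw [Even.neg_one_pow (Nat.even_iff.2 (by omega))] at hsub
    linarith
  · rw [Odd.neg_one_pow (Nat.odd_iff.2 (by omega))] at hsub
    linarith
end

section
/- Let P be the Pell sequence (P_0 = 0, P_1 = 1, P_n = 2P_{n-1} + P_{n-2}), B the balancing sequence (B_0 = 0, B_1 = 1, B_n = 6B_{n-1} − B_{n-2}), Q the associated Pell sequence (Q_0 = 1, Q_1 = 1, Q_n = 2Q_{n-1} + Q_{n-2}), and c the Lucas-cobalancing sequence (c_0 = −1, c_1 = 1, c_n = 6c_{n-1} − c_{n-2}). For all k ≥ 1: 4·Σ_{i=1}^{k} B_i = P_{2k+1} − 1 and 2·Σ_{i=1}^{k} c_i = Q_{2k} − 1. -/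
/-- The balancing sequence: B₀ = 0, B₁ = 1, Bₙ = 6Bₙ₋₁ − Bₙ₋₂. -/
def balancing : ℕ → ℤ
  | 0 => 0
  | 1 => 1
  | n + 2 => 6 * balancing (n + 1) - balancing n

/-- The Lucas-cobalancing sequence: c₀ = −1, c₁ = 1, cₙ = 6cₙ₋₁ − cₙ₋₂. -/
def lucasCobalancing : ℕ → ℤ
  | 0 => -1
  | 1 => 1
  | n + 2 => 6 * lucasCobalancing (n + 1) - lucasCobalancing n

theorem pell_two_mul (n : ℕ) : pell (2 * n) = 2 * balancing n := by
  induction n using Nat.twoStepInduction with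
  | zero => simp [pell, balancing]
  | one => simp [pell, balancing]
  | more n ih₀ ih₁ =>
    simp only [Nat.mul_add, Nat.mul_one, pell, balancing] at *
    linarith

theorem assocPell_two_mul_add_one (n : ℕ) :
    assocPell (2 * n + 1) = lucasCobalancing (n + 1) := by
  induction n using Nat.twoStepInduction with
  | zero => simp [assocPell, lucasCobalancing]
  | one => simp [assocPell, lucasCobalancing]
  | more n ih₀ ih₁ =>
    rw [lucasCobalancing, ← ih₀, ← ih₁]
    simp only [Nat.mul_add, Nat.mul_one, assocPell]
    ring

theorem sum_balancing_and_sum_lucasCobalancing (k : ℕ) (hk : 1 ≤ k) :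
    4 * (∑ i ∈ Finset.Icc 1 k, balancing i) = pell (2 * k + 1) - 1 ∧
    2 * (∑ i ∈ Finset.Icc 1 k, lucasCobalancing i) = assocPell (2 * k) - 1 := by
  clear hk
  induction k with
  | zero => simp [pell, assocPell]
  | succ k ih =>
    have hP : pell (2 * (k + 1) + 1) = 2 * pell (2 * (k + 1)) + pell (2 * k + 1) := rfl
    have hQ : assocPell (2 * (k + 1)) = 2 * assocPell (2 * k + 1) + assocPell (2 * k) := rfl
    rw [Finset.sum_Icc_succ_top (by omega), Finset.sum_Icc_succ_top (by omega), hP, hQ,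
      pell_two_mul, assocPell_two_mul_add_one]
    constructor <;> linarith [ih.1, ih.2]
end
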